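/- For every n ≥ 0, x_{n+1} ≥ (1/π1)·θ⁴·x_n². -/

import Mathlib

open Finset Filter

namespace AsymIsing

/-- Level-`k` vertices of the rooted `d`-ary tree: paths of length `k` from the root. -/
abbrev Vert (d k : ℕ) : Type := Fin k → Fin d

/-- A spin configuration on levels `0, …, n` of the `d`-ary tree. -/
abbrev Conf (d n : ℕ) : Type := ∀ k : Fin (n + 1), Vert d k → Fin 2

/-- A spin configuration on level `n` only. -/
abbrev LConf (d n : ℕ) : Type := Vert d n → Fin 2

/-- The transition matrix of the asymmetric binary channel; the paper's state `1`
corresponds to the index `0` and the state `2` to the index `1`. -/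
noncomputable def Mmat (θ Δ : ℝ) : Fin 2 → Fin 2 → ℝ := fun i j =>
  if i = 0 then (if j = 0 then (1 + θ - Δ) / 2 else (1 - θ + Δ) / 2)
  else (if j = 0 then (1 - θ - Δ) / 2 else (1 + θ + Δ) / 2)

/-- The stationary distribution `π = (π₁, π₂)` of the channel. -/
noncomputable def pst (θ Δ : ℝ) : Fin 2 → ℝ := fun i =>
  if i = 0 then 1 / 2 - Δ / (2 * (1 - θ)) else 1 / 2 + Δ / (2 * (1 - θ))

/-- The root spin of a configuration. -/
def root {d n : ℕ} (σ : Conf d n) : Fin 2 := σ ⟨0, n.succ_pos⟩ (fun i => i.elim0)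

/-- The restriction of a configuration to the last (`n`-th) level. -/
def top {d n : ℕ} (σ : Conf d n) : LConf d n := σ (Fin.last n)

/-- The probability of a full configuration on levels `0, …, n` under the broadcast
process: the root is drawn from `π` and spins propagate along edges via `M`. -/
noncomputable def confProb (d : ℕ) (θ Δ : ℝ) (n : ℕ) (σ : Conf d n) : ℝ :=
  pst θ Δ (root σ) *
    ∏ k : Fin n, ∏ v : Vert d (k + 1),
      Mmat θ Δ (σ k.castSucc (v ∘ Fin.castSucc)) (σ k.succ v)

/-- `P(σ(n) = A)`: the marginal law of the level-`n` spins. -/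
noncomputable def levelProb (d : ℕ) (θ Δ : ℝ) (n : ℕ) (A : LConf d n) : ℝ :=
  ∑ σ : Conf d n, if top σ = A then confProb d θ Δ n σ else 0

/-- `P(σ_ρ = i, σ(n) = A)`. -/
noncomputable def jointProb (d : ℕ) (θ Δ : ℝ) (n : ℕ) (i : Fin 2) (A : LConf d n) : ℝ :=
  ∑ σ : Conf d n, if root σ = i ∧ top σ = A then confProb d θ Δ n σ else 0

/-- The posterior `f_n(i, A) = P(σ_ρ = i ∣ σ(n) = A)`. -/
noncomputable def post (d : ℕ) (θ Δ : ℝ) (n : ℕ) (i : Fin 2) (A : LConf d n) : ℝ :=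
  jointProb d θ Δ n i A / levelProb d θ Δ n A

/-- The law of `σ^i(n)`, i.e. `P(σ(n) = A ∣ σ_ρ = i)`. -/
noncomputable def condLevel (d : ℕ) (θ Δ : ℝ) (n : ℕ) (i : Fin 2) (A : LConf d n) : ℝ :=
  jointProb d θ Δ n i A / pst θ Δ i

/-- The total variation distance between `σ^1(n)` and `σ^2(n)`. -/
noncomputable def tvDist (d : ℕ) (θ Δ : ℝ) (n : ℕ) : ℝ :=
  (1 / 2) * ∑ A : LConf d n, |condLevel d θ Δ n 0 A - condLevel d θ Δ n 1 A|

/-- The reconstruction problem is solvable if `limsup_n d_TV(σ^1(n), σ^2(n)) > 0`. -/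
def solvable (d : ℕ) (θ Δ : ℝ) : Prop :=
  0 < Filter.limsup (fun n => tvDist d θ Δ n) Filter.atTop

/-- Non-reconstruction: `limsup_n d_TV(σ^1(n), σ^2(n)) = 0`. -/
def nonReconstruction (d : ℕ) (θ Δ : ℝ) : Prop :=
  Filter.limsup (fun n => tvDist d θ Δ n) Filter.atTop = 0

/-- Expectation of a function of the level-`n` configuration, conditioned on `σ_ρ = 1`. -/
noncomputable def expect1 (d : ℕ) (θ Δ : ℝ) (n : ℕ) (g : LConf d n → ℝ) : ℝ :=
  ∑ A : LConf d n, condLevel d θ Δ n 0 A * g A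

/-- `x_n = E f_n(1, σ^1(n)) − π₁`. -/
noncomputable def xseq (d : ℕ) (θ Δ : ℝ) (n : ℕ) : ℝ :=
  expect1 d θ Δ n (fun A => post d θ Δ n 0 A) - pst θ Δ 0

/-- `z_n = E (f_n(1, σ^1(n)) − π₁)²`. -/
noncomputable def zseq (d : ℕ) (θ Δ : ℝ) (n : ℕ) : ℝ :=
  expect1 d θ Δ n (fun A => (post d θ Δ n 0 A - pst θ Δ 0) ^ 2)

/-- The restriction of a level-`(n+1)` configuration to the subtree of the `j`-th
child of the root (paths starting with `j`). -/
def restrictChild {d n : ℕ} (j : Fin d) (A : LConf d (n + 1)) : LConf d n :=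
  fun w => A (Fin.cons j w)

/-- `Y_j = f_n(1, σ_j(n+1))`, as a function of the level-`(n+1)` configuration. -/
noncomputable def Yfun (d : ℕ) (θ Δ : ℝ) (n : ℕ) (j : Fin d) (A : LConf d (n + 1)) : ℝ :=
  post d θ Δ n 0 (restrictChild j A)

/-- `Z₁ = ∏_j (1 + (θ/π₁)(Y_j − π₁))`, as a function of the level-`(n+1)` configuration. -/
noncomputable def Z1fun (d : ℕ) (θ Δ : ℝ) (n : ℕ) (A : LConf d (n + 1)) : ℝ :=
  ∏ j : Fin d, (1 + (θ / pst θ Δ 0) * (Yfun d θ Δ n j A - pst θ Δ 0))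

/-- `Z₂ = ∏_j (1 − (θ/π₂)(Y_j − π₁))`, as a function of the level-`(n+1)` configuration. -/
noncomputable def Z2fun (d : ℕ) (θ Δ : ℝ) (n : ℕ) (A : LConf d (n + 1)) : ℝ :=
  ∏ j : Fin d, (1 - (θ / pst θ Δ 1) * (Yfun d θ Δ n j A - pst θ Δ 0))

/-- The value of `Δ` making `π = (π₁, π₂)` the stationary distribution of the channel
with second eigenvalue `θ`, namely `Δ = (1 − θ)(π₂ − π₁)`. -/
noncomputable def Dlt (θ π1 π2 : ℝ) : ℝ := (1 - θ) * (π2 - π1)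

/-- The Gaussian-approximation function
`f(s) = E[π₁ e^{sμ₁+√s W₁} / (π₁ e^{sμ₁+√s W₁} + π₂ e^{sμ₂+√s W₂})] − π₁`,
where `μ₁ = 1/(2π₁)`, `μ₂ = −(1+π₂)/(2π₂²)`, `W₁ ∼ N(0, 1/π₁)` (realized as `w/√π₁`
for `w` standard Gaussian) and `W₂ = −(π₁/π₂)·W₁`. -/
noncomputable def gfun (π1 π2 : ℝ) (s : ℝ) : ℝ :=
  (∫ w : ℝ,
      (π1 * Real.exp (s * (1 / (2 * π1)) + Real.sqrt s * (w / Real.sqrt π1))) /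
        (π1 * Real.exp (s * (1 / (2 * π1)) + Real.sqrt s * (w / Real.sqrt π1)) +
          π2 * Real.exp (s * (-(1 + π2) / (2 * π2 ^ 2)) +
            Real.sqrt s * (-(π1 / π2) * (w / Real.sqrt π1))))
    ∂(ProbabilityTheory.gaussianReal 0 1)) - π1

/-- The weight of a full configuration given its root spin: the product of the transition
probabilities along the edges. -/
noncomputable def edgeWeight (d : ℕ) (θ Δ : ℝ) (n : ℕ) (σ : Conf d n) : ℝ :=
  ∏ k : Fin n, ∏ v : Vert d (k + 1),
    Mmat θ Δ (σ k.castSucc (v ∘ Fin.castSucc)) (σ k.succ v)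

/-- `E[G(σ(n)) ∣ σ_ρ = i]`, as a sum over full configurations. -/
noncomputable def condExp (d : ℕ) (θ Δ : ℝ) (n : ℕ) (i : Fin 2) (G : LConf d n → ℝ) : ℝ :=
  ∑ σ : Conf d n, if root σ = i then edgeWeight d θ Δ n σ * G (top σ) else 0

/-- The configuration with root spin `r` and configuration `c j` below the `j`-th child. -/
def glue {d n : ℕ} (r : Fin 2) (c : Fin d → Conf d n) : Conf d (n + 1) :=
  Fin.cons (α := fun k : Fin (n + 2) => Vert d k → Fin 2) (fun _ => r)
    (fun k (v : Vert d (k + 1)) => c (v 0) k (Fin.tail v))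

/-- A configuration is a root spin together with the configurations below the children. -/
def glueEquiv (d n : ℕ) : Fin 2 × (Fin d → Conf d n) ≃ Conf d (n + 1) where
  toFun x := glue x.1 x.2
  invFun σ := (root σ, fun j k v => σ k.succ (Fin.cons (α := fun _ => Fin d) j v))
  left_inv := by
    rintro ⟨r, c⟩
    rfl
  right_inv := by
    intro σ
    funext k v
    refine Fin.cases (motive := fun k => ∀ v : Vert d k, glue (root σ)
      (fun j k v => σ k.succ (Fin.cons (α := fun _ => Fin d) j v)) k v = σ k v) ?_ ?_ k v
    · intro v
      exact congrArg (σ 0) (funext fun i => i.elim0)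
    · intro k v
      exact congrArg (σ k.succ) (Fin.cons_self_tail (α := fun _ => Fin d) v)

theorem edgeWeight_glue {d n : ℕ} (θ Δ : ℝ) (r : Fin 2) (c : Fin d → Conf d n) :
    edgeWeight d θ Δ (n + 1) (glue r c) =
      ∏ j, Mmat θ Δ r (root (c j)) * edgeWeight d θ Δ n (c j) := by
  unfold edgeWeight
  rw [Fin.prod_univ_succ, Finset.prod_mul_distrib]
  congr 1
  · refine Fintype.prod_equiv (Equiv.funUnique (Fin 1) (Fin d)) _ _ fun v => ?_
    change Mmat θ Δ r (c (v 0) 0 (Fin.tail v)) = Mmat θ Δ r (c (v 0) 0 fun i => i.elim0)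
    congr 2
    exact funext fun i => i.elim0
  · rw [Finset.prod_comm]
    refine Finset.prod_congr rfl fun k _ => ?_
    rw [← Fintype.prod_prod_type']
    exact (Fintype.prod_equiv (Fin.consEquiv (n := k + 1) (fun _ => Fin d)) _ _ fun x => rfl).symm

theorem condExp_restrictChild {d n : ℕ} (θ Δ : ℝ) (i : Fin 2) (g : Fin d → LConf d n → ℝ) :
    condExp d θ Δ (n + 1) i (fun A => ∏ j, g j (restrictChild j A)) =
      ∏ j, ∑ k, Mmat θ Δ i k * condExp d θ Δ n k (g j) := by
  have hfac (j : Fin d) : ∑ k, Mmat θ Δ i k * condExp d θ Δ n k (g j) =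
      ∑ σ : Conf d n, Mmat θ Δ i (root σ) * edgeWeight d θ Δ n σ * g j (top σ) := by
    simp only [condExp, Finset.mul_sum]
    rw [Finset.sum_comm]
    refine Finset.sum_congr rfl fun σ _ => ?_
    simp [mul_assoc]
  simp only [hfac]
  rw [Finset.prod_univ_sum, Fintype.piFinset_univ, condExp,
    ← Fintype.sum_equiv (glueEquiv d n) _ _ fun _ => rfl, Fintype.sum_prod_type,
    Finset.sum_eq_single i]
  · refine Finset.sum_congr rfl fun c _ => ?_
    change (if i = i then edgeWeight d θ Δ (n + 1) (glue i c) * ∏ j, g j (top (c j)) else 0) = _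
    rw [if_pos rfl, edgeWeight_glue, ← Finset.prod_mul_distrib]
  · intro r _ hr
    exact Finset.sum_eq_zero fun c _ => if_neg hr
  · simp

theorem sum_Mmat (θ Δ : ℝ) (i : Fin 2) : ∑ k, Mmat θ Δ i k = 1 := by
  fin_cases i <;> simp [Mmat] <;> ring

theorem condExp_one (d : ℕ) (θ Δ : ℝ) (n : ℕ) (i : Fin 2) :
    condExp d θ Δ n i (fun _ => 1) = 1 := by
  induction n generalizing i with
  | zero =>
    let e : Fin 2 ≃ Conf d 0 :=
      { toFun := fun r _ _ => r
        invFun := root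
        left_inv := fun _ => rfl
        right_inv := fun σ => by
          funext k v
          obtain rfl : k = 0 := Fin.fin_one_eq_zero k
          exact congrArg (σ 0) (funext fun i => i.elim0) }
    rw [condExp, ← Fintype.sum_equiv e _ _ fun _ => rfl]
    simp only [edgeWeight, Finset.univ_eq_empty, Finset.prod_empty, mul_one]
    change ∑ r, (if r = i then (1 : ℝ) else 0) = 1
    simp
  | succ n ih =>
    simpa only [ih, mul_one, sum_Mmat, Finset.prod_const_one] using condExp_restrictChild θ Δ i (fun (_ : Fin d) (_ : LConf d n) => 1)

theorem condExp_comp_restrictChild {d n : ℕ} (θ Δ : ℝ) (i : Fin 2) (j : Fin d)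
    (G : LConf d n → ℝ) :
    condExp d θ Δ (n + 1) i (fun A => G (restrictChild j A)) =
      ∑ k, Mmat θ Δ i k * condExp d θ Δ n k G := by
  have h := condExp_restrictChild θ Δ i (Function.update (fun (_ : Fin d) (_ : LConf d n) => 1) j G)
  rw [Fintype.prod_eq_single j, Function.update_self] at h
  · rw [← h]
    congr 1
    funext A
    rw [Fintype.prod_eq_single j, Function.update_self]
    intro l hl
    rw [Function.update_of_ne hl]
  · intro l hl
    simp only [Function.update_of_ne hl, condExp_one, mul_one, sum_Mmat]

theorem sum_jointProb_mul {d n : ℕ} (θ Δ : ℝ) (i : Fin 2) (G : LConf d n → ℝ) :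
    ∑ A, jointProb d θ Δ n i A * G A = pst θ Δ i * condExp d θ Δ n i G := by
  simp only [jointProb, condExp, Finset.sum_mul, Finset.mul_sum]
  rw [Finset.sum_comm]
  refine Finset.sum_congr rfl fun σ _ => ?_
  by_cases h : root σ = i
  · subst h
    simp [confProb, edgeWeight, mul_assoc]
  · simp [h]

theorem levelProb_eq_add {d n : ℕ} (θ Δ : ℝ) (A : LConf d n) :
    levelProb d θ Δ n A = jointProb d θ Δ n 0 A + jointProb d θ Δ n 1 A := by
  simp only [levelProb, jointProb, ← Finset.sum_add_distrib]
  refine Finset.sum_congr rfl fun σ _ => ?_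
  obtain h | h : root σ = 0 ∨ root σ = 1 := by omega
  all_goals simp [h]

section Positivity

variable {θ Δ : ℝ}

theorem pst_pos (hθ1 : |θ| < 1) (hM : ∀ i j, 0 < Mmat θ Δ i j) (i : Fin 2) : 0 < pst θ Δ i := by
  have hθ : 0 < 1 - θ := by linarith [(abs_lt.mp hθ1).2]
  have h0 : pst θ Δ 0 = Mmat θ Δ 1 0 / (1 - θ) := by
    simp only [pst, Mmat, one_ne_zero, if_true, if_false]
    field_simp
  have h1 : pst θ Δ 1 = Mmat θ Δ 0 1 / (1 - θ) := by
    simp only [pst, Mmat, one_ne_zero, if_true, if_false]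
    field_simp
  obtain rfl | rfl : i = 0 ∨ i = 1 := by omega
  · rw [h0]
    exact div_pos (hM 1 0) hθ
  · rw [h1]
    exact div_pos (hM 0 1) hθ

theorem jointProb_nonneg {d n : ℕ} (hπ : ∀ i, 0 < pst θ Δ i) (hM : ∀ i j, 0 < Mmat θ Δ i j)
    (i : Fin 2) (A : LConf d n) : 0 ≤ jointProb d θ Δ n i A := by
  refine Finset.sum_nonneg fun σ _ => ?_
  split_ifs
  · exact mul_nonneg (hπ _).le
      (Finset.prod_nonneg fun k _ => Finset.prod_nonneg fun v _ => (hM _ _).le)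
  · exact le_rfl

theorem levelProb_nonneg {d n : ℕ} (hπ : ∀ i, 0 < pst θ Δ i) (hM : ∀ i j, 0 < Mmat θ Δ i j)
    (A : LConf d n) : 0 ≤ levelProb d θ Δ n A := by
  rw [levelProb_eq_add]
  exact add_nonneg (jointProb_nonneg hπ hM 0 A) (jointProb_nonneg hπ hM 1 A)

theorem levelProb_mul_post {d n : ℕ} (hπ : ∀ i, 0 < pst θ Δ i) (hM : ∀ i j, 0 < Mmat θ Δ i j)
    (A : LConf d n) : levelProb d θ Δ n A * post d θ Δ n 0 A = jointProb d θ Δ n 0 A := by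
  refine mul_div_cancel_of_imp' fun h => ?_
  have h0 := jointProb_nonneg hπ hM 0 A
  have h1 := jointProb_nonneg hπ hM 1 A
  rw [levelProb_eq_add] at h
  linarith

theorem post_le_one {d n : ℕ} (hπ : ∀ i, 0 < pst θ Δ i) (hM : ∀ i j, 0 < Mmat θ Δ i j)
    (A : LConf d n) : post d θ Δ n 0 A ≤ 1 := by
  refine div_le_one_of_le₀ ?_ (levelProb_nonneg hπ hM A)
  rw [levelProb_eq_add]
  exact le_add_of_nonneg_right (jointProb_nonneg hπ hM 1 A)

end Positivity

theorem sum_levelProb_mul {d n : ℕ} (θ Δ : ℝ) (G : LConf d n → ℝ) :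
    ∑ A, levelProb d θ Δ n A * G A =
      pst θ Δ 0 * condExp d θ Δ n 0 G + pst θ Δ 1 * condExp d θ Δ n 1 G := by
  simp only [levelProb_eq_add, add_mul, Finset.sum_add_distrib, sum_jointProb_mul]

theorem pst_add {θ Δ : ℝ} : pst θ Δ 0 + pst θ Δ 1 = 1 := by
  simp only [pst, one_ne_zero, if_true, if_false]
  ring

theorem pst_mul_Mmat_zero_one {θ Δ : ℝ} (hθ : 1 - θ ≠ 0) :
    pst θ Δ 0 * Mmat θ Δ 0 1 = pst θ Δ 1 * Mmat θ Δ 1 0 := by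
  simp only [pst, Mmat, one_ne_zero, if_true, if_false]
  field_simp

theorem Mmat_zero_zero_sub {θ Δ : ℝ} : Mmat θ Δ 0 0 - Mmat θ Δ 1 0 = θ := by
  simp only [Mmat, one_ne_zero, if_true, if_false]
  ring

/-- Stationarity: a child's subtree has the same unconditional law as the whole tree. -/
theorem sum_levelProb_succ_mul {d n : ℕ} {θ Δ : ℝ} (hθ : 1 - θ ≠ 0) (j : Fin d)
    (G : LConf d n → ℝ) :
    ∑ A, levelProb d θ Δ (n + 1) A * G (restrictChild j A) = ∑ B, levelProb d θ Δ n B * G B := by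
  have hrev := pst_mul_Mmat_zero_one (Δ := Δ) hθ
  have h0 := sum_Mmat θ Δ 0
  have h1 := sum_Mmat θ Δ 1
  rw [sum_levelProb_mul θ Δ (fun A => G (restrictChild j A)), sum_levelProb_mul,
    condExp_comp_restrictChild, condExp_comp_restrictChild]
  simp only [Fin.sum_univ_two] at h0 h1 ⊢
  linear_combination (pst θ Δ 0 * condExp d θ Δ n 0 G) * h0 +
    (pst θ Δ 1 * condExp d θ Δ n 1 G) * h1 +
    (condExp d θ Δ n 1 G - condExp d θ Δ n 0 G) * hrev

section Variance

variable {d : ℕ} {θ Δ : ℝ}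

theorem pst_mul_xseq (n : ℕ) (hπ : pst θ Δ 0 ≠ 0) :
    pst θ Δ 0 * xseq d θ Δ n =
      ∑ A, jointProb d θ Δ n 0 A * post d θ Δ n 0 A - pst θ Δ 0 ^ 2 := by
  have h (A : LConf d n) : condLevel d θ Δ n 0 A * post d θ Δ n 0 A =
      (jointProb d θ Δ n 0 A * post d θ Δ n 0 A) / pst θ Δ 0 := by
    rw [condLevel]
    ring
  simp only [xseq, expect1, h, ← Finset.sum_div]
  field_simp

theorem sum_levelProb (n : ℕ) : ∑ A, levelProb d θ Δ n A = 1 := by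
  simpa [condExp_one, pst_add] using sum_levelProb_mul θ Δ (fun _ : LConf d n => 1)

theorem sum_jointProb (n : ℕ) (i : Fin 2) : ∑ A, jointProb d θ Δ n i A = pst θ Δ i := by
  simpa [condExp_one] using sum_jointProb_mul θ Δ i (fun _ : LConf d n => 1)

theorem sum_levelProb_mul_post (hπ : ∀ i, 0 < pst θ Δ i) (hM : ∀ i j, 0 < Mmat θ Δ i j) (n : ℕ) :
    ∑ A, levelProb d θ Δ n A * post d θ Δ n 0 A = pst θ Δ 0 := by
  simp only [levelProb_mul_post hπ hM, sum_jointProb]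

theorem sum_levelProb_mul_post_sq (hπ : ∀ i, 0 < pst θ Δ i) (hM : ∀ i j, 0 < Mmat θ Δ i j)
    (n : ℕ) : ∑ A, levelProb d θ Δ n A * post d θ Δ n 0 A ^ 2 =
      pst θ Δ 0 * xseq d θ Δ n + pst θ Δ 0 ^ 2 := by
  rw [pst_mul_xseq n (hπ 0).ne', sub_add_cancel]
  refine Finset.sum_congr rfl fun A _ => ?_
  rw [sq, ← mul_assoc, levelProb_mul_post hπ hM]

theorem xseq_nonneg (hπ : ∀ i, 0 < pst θ Δ i) (hM : ∀ i j, 0 < Mmat θ Δ i j) (n : ℕ) :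
    0 ≤ xseq d θ Δ n := by
  have h : 0 ≤ ∑ A, levelProb d θ Δ n A * (post d θ Δ n 0 A - pst θ Δ 0) ^ 2 :=
    Finset.sum_nonneg fun A _ => mul_nonneg (levelProb_nonneg hπ hM A) (sq_nonneg _)
  have hexp : ∑ A, levelProb d θ Δ n A * (post d θ Δ n 0 A - pst θ Δ 0) ^ 2 =
      ∑ A, levelProb d θ Δ n A * post d θ Δ n 0 A ^ 2 -
        2 * pst θ Δ 0 * ∑ A, levelProb d θ Δ n A * post d θ Δ n 0 A +
        pst θ Δ 0 ^ 2 * ∑ A, levelProb d θ Δ n A := by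
    simp only [Finset.mul_sum, ← Finset.sum_sub_distrib, ← Finset.sum_add_distrib]
    exact Finset.sum_congr rfl fun A _ => by ring
  rw [hexp, sum_levelProb_mul_post_sq hπ hM, sum_levelProb_mul_post hπ hM, sum_levelProb] at h
  exact (mul_nonneg_iff_of_pos_left (hπ 0)).mp (by linarith)

theorem xseq_le_pst_one (hπ : ∀ i, 0 < pst θ Δ i) (hM : ∀ i j, 0 < Mmat θ Δ i j) (n : ℕ) :
    xseq d θ Δ n ≤ pst θ Δ 1 := by
  have h : ∑ A, jointProb d θ Δ n 0 A * post d θ Δ n 0 A ≤ pst θ Δ 0 := by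
    rw [← sum_jointProb (d := d) n 0]
    exact Finset.sum_le_sum fun A _ =>
      mul_le_of_le_one_right (jointProb_nonneg hπ hM 0 A) (post_le_one hπ hM A)
  refine le_of_mul_le_mul_left ?_ (hπ 0)
  rw [pst_mul_xseq n (hπ 0).ne', eq_sub_of_add_eq' (pst_add (θ := θ) (Δ := Δ))]
  linarith

/-- The correlation of the event `σ_ρ = 1` with the posterior of a child. -/
theorem sum_jointProb_mul_Yfun (hθ : 1 - θ ≠ 0) (hπ : ∀ i, 0 < pst θ Δ i)
    (hM : ∀ i j, 0 < Mmat θ Δ i j) (n : ℕ) (j : Fin d) :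
    ∑ A, jointProb d θ Δ (n + 1) 0 A * Yfun d θ Δ n j A =
      pst θ Δ 0 * (pst θ Δ 0 + θ * xseq d θ Δ n) := by
  have hx := pst_mul_xseq (d := d) n (hπ 0).ne'
  have hl := sum_levelProb_mul_post (d := d) hπ hM n
  rw [sum_jointProb_mul] at hx
  rw [sum_levelProb_mul] at hl
  simp only [Yfun]
  rw [sum_jointProb_mul θ Δ 0 (fun A => post d θ Δ n 0 (restrictChild j A)),
    condExp_comp_restrictChild]
  have hrev := pst_mul_Mmat_zero_one (Δ := Δ) hθ
  have h0 := sum_Mmat θ Δ 0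
  have hdiff := Mmat_zero_zero_sub (θ := θ) (Δ := Δ)
  simp only [Fin.sum_univ_two] at h0 ⊢
  set a := condExp d θ Δ n 0 (post d θ Δ n 0)
  set b := condExp d θ Δ n 1 (post d θ Δ n 0)
  linear_combination (-θ) * hx + Mmat θ Δ 1 0 * hl + b * hrev + pst θ Δ 0 * a * hdiff +
    pst θ Δ 0 * (-Mmat θ Δ 1 0 * pst_add - hrev + pst θ Δ 0 * h0 - pst θ Δ 0 * hdiff)

/-- Guessing the root spin from one child's subtree loses at most a factor `θ ^ 2`. -/
theorem sq_mul_xseq_le_xseq_succ (hθ : 1 - θ ≠ 0) (hπ : ∀ i, 0 < pst θ Δ i)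
    (hM : ∀ i j, 0 < Mmat θ Δ i j) (n : ℕ) (j : Fin d) :
    θ ^ 2 * xseq d θ Δ n ≤ xseq d θ Δ (n + 1) := by
  have h : 0 ≤ ∑ A, levelProb d θ Δ (n + 1) A *
      (post d θ Δ (n + 1) 0 A - pst θ Δ 0 - θ * (Yfun d θ Δ n j A - pst θ Δ 0)) ^ 2 :=
    Finset.sum_nonneg fun A _ => mul_nonneg (levelProb_nonneg hπ hM A) (sq_nonneg _)
  have hexp : ∑ A, levelProb d θ Δ (n + 1) A *
      (post d θ Δ (n + 1) 0 A - pst θ Δ 0 - θ * (Yfun d θ Δ n j A - pst θ Δ 0)) ^ 2 =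
      ∑ A, levelProb d θ Δ (n + 1) A * post d θ Δ (n + 1) 0 A ^ 2 +
        θ ^ 2 * ∑ A, levelProb d θ Δ (n + 1) A * Yfun d θ Δ n j A ^ 2 +
        (1 - θ) ^ 2 * pst θ Δ 0 ^ 2 * ∑ A, levelProb d θ Δ (n + 1) A -
        2 * θ * ∑ A, jointProb d θ Δ (n + 1) 0 A * Yfun d θ Δ n j A -
        2 * (1 - θ) * pst θ Δ 0 * ∑ A, levelProb d θ Δ (n + 1) A * post d θ Δ (n + 1) 0 A +
        2 * θ * (1 - θ) * pst θ Δ 0 * ∑ A, levelProb d θ Δ (n + 1) A * Yfun d θ Δ n j A := by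
    simp only [← levelProb_mul_post hπ hM, Finset.mul_sum, ← Finset.sum_sub_distrib,
      ← Finset.sum_add_distrib]
    exact Finset.sum_congr rfl fun A _ => by ring
  have hY : ∑ A, levelProb d θ Δ (n + 1) A * Yfun d θ Δ n j A = pst θ Δ 0 :=
    (sum_levelProb_succ_mul hθ j _).trans (sum_levelProb_mul_post hπ hM n)
  have hY2 : ∑ A, levelProb d θ Δ (n + 1) A * Yfun d θ Δ n j A ^ 2 =
      pst θ Δ 0 * xseq d θ Δ n + pst θ Δ 0 ^ 2 :=
    (sum_levelProb_succ_mul hθ j fun B => post d θ Δ n 0 B ^ 2).trans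
      (sum_levelProb_mul_post_sq hπ hM n)
  rw [hexp, hY, hY2, sum_levelProb_mul_post_sq hπ hM, sum_levelProb_mul_post hπ hM,
    sum_levelProb, sum_jointProb_mul_Yfun hθ hπ hM] at h
  refine le_of_mul_le_mul_left ?_ (hπ 0)
  linarith

end Variance

/-- For every `n ≥ 0`, `x_{n+1} ≥ (1/π₁)·θ⁴·x_n²`. -/
theorem xseq_succ_lower_bound (d : ℕ) (hd : 2 ≤ d) (θ Δ : ℝ) (hθ0 : θ ≠ 0) (hθ1 : |θ| < 1)
    (hθΔ : |θ| + |Δ| ≤ 1) (hM : ∀ i j, 0 < Mmat θ Δ i j)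
    (hord : pst θ Δ 1 ≤ pst θ Δ 0) :
    ∀ n : ℕ, (1 / pst θ Δ 0) * θ ^ 4 * xseq d θ Δ n ^ 2 ≤ xseq d θ Δ (n + 1) := by
  intro n
  have hθ : 1 - θ ≠ 0 := (sub_pos.mpr (abs_lt.mp hθ1).2).ne'
  have hπ := pst_pos hθ1 hM
  have hx0 := xseq_nonneg (d := d) hπ hM n
  have hxp := (xseq_le_pst_one (d := d) hπ hM n).trans hord
  have hθ2 : θ ^ 2 ≤ 1 := (sq_le_one_iff_abs_le_one θ).mpr hθ1.le
  refine le_trans ?_ (sq_mul_xseq_le_xseq_succ hθ hπ hM n ⟨0, by omega⟩)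
  calc (1 / pst θ Δ 0) * θ ^ 4 * xseq d θ Δ n ^ 2
      = θ ^ 2 * xseq d θ Δ n * (θ ^ 2 * (xseq d θ Δ n / pst θ Δ 0)) := by ring
    _ ≤ θ ^ 2 * xseq d θ Δ n := by
      refine mul_le_of_le_one_right (by positivity) (mul_le_one₀ hθ2 ?_ ?_)
      · exact div_nonneg hx0 (hπ 0).le
      · exact div_le_one_of_le₀ hxp (hπ 0).le

end AsymIsing
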